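/- Define N(p,q;s) = Σ over (μ,ν) ∈ C(s,p) × C(s,q) of the discrete Earth Mover's Distance EMD(μ,ν), with the convention N(p',q';s') = 0 whenever p' = 0 or q' = 0, and define K(p,q;s) = C(s+p-1, p-1) · C(s+q-1, q-1). Then for all p, q ≥ 1 with (p,q) ≠ (1,1) and all s ≥ 1: N(p,q;s) = N(p-1,q;s) + N(p,q-1;s) - N(p-1,q-1;s) + N(p,q;s-1) + |p - q| · K(p,q;s-1). -/

import Mathlib

/-- Transport cost of a discrete plan, with cost `|i - j|` between indices. -/
def discCost {p q : ℕ} (J : Fin p → Fin q → ℕ) : ℕ :=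
  ∑ i : Fin p, ∑ j : Fin q, ((i : ℤ) - (j : ℤ)).natAbs * J i j

/-- The discrete Earth Mover's Distance between compositions. -/
noncomputable def discEMD {p q : ℕ} (μ : Fin p → ℕ) (ν : Fin q → ℕ) : ℕ :=
  sInf {c | ∃ J : Fin p → Fin q → ℕ,
    (∀ i, ∑ j, J i j = μ i) ∧ (∀ j, ∑ i, J i j = ν j) ∧ c = discCost J}

/-- `N(p,q;s)`: the sum of the discrete EMD over all pairs of compositions, with the
convention that it vanishes when `p = 0` or `q = 0`. -/
noncomputable def Nsum (p q s : ℕ) : ℕ :=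
  if p = 0 ∨ q = 0 then 0
  else ∑ μ ∈ Finset.Nat.antidiagonalTuple p s, ∑ ν ∈ Finset.Nat.antidiagonalTuple q s,
    discEMD μ ν

/-- `K(p,q;s)`: the number of pairs of compositions of `s` into `p` and `q` parts. -/
def Kcount (p q s : ℕ) : ℕ :=
  Nat.choose (s + p - 1) (p - 1) * Nat.choose (s + q - 1) (q - 1)

open Finset Finset.Nat

/-- `J` is a transport plan with marginals `μ` and `ν`. -/
def IsTransportPlan {p q : ℕ} (J : Fin p → Fin q → ℕ) (μ : Fin p → ℕ) (ν : Fin q → ℕ) : Prop :=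
  (∀ i, ∑ j, J i j = μ i) ∧ (∀ j, ∑ i, J i j = ν j)

/-- The plan moving a single unit of mass from `a` to `b`. -/
def unitPlan {p q : ℕ} (a : Fin p) (b : Fin q) : Fin p → Fin q → ℕ :=
  Pi.single a (Pi.single b 1)

theorem discCost_add {p q : ℕ} (J K : Fin p → Fin q → ℕ) :
    discCost (J + K) = discCost J + discCost K := by
  simp [discCost, mul_add, sum_add_distrib]

theorem unitPlan_apply {p q : ℕ} (a i : Fin p) (b j : Fin q) :
    unitPlan a b i j = if i = a ∧ j = b then 1 else 0 := by
  by_cases h : i = a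
  · subst h; simp [unitPlan, Pi.single_apply]
  · simp [unitPlan, h]

theorem discCost_unitPlan {p q : ℕ} (a : Fin p) (b : Fin q) :
    discCost (unitPlan a b) = ((a : ℤ) - (b : ℤ)).natAbs := by
  simp [discCost, unitPlan_apply, ite_and]

theorem isTransportPlan_unitPlan {p q : ℕ} (a : Fin p) (b : Fin q) :
    IsTransportPlan (unitPlan a b) (Pi.single a 1) (Pi.single b 1) := by
  constructor <;> intro i <;> simp [unitPlan_apply, ite_and, Pi.single_apply]

namespace IsTransportPlan

variable {p q : ℕ} {J K : Fin p → Fin q → ℕ} {μ μ' : Fin p → ℕ} {ν ν' : Fin q → ℕ}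

theorem add (hJ : IsTransportPlan J μ ν) (hK : IsTransportPlan K μ' ν') :
    IsTransportPlan (J + K) (μ + μ') (ν + ν') := by
  constructor <;> intro i <;> simp [sum_add_distrib, hJ.1, hJ.2, hK.1, hK.2]

theorem of_add (h : IsTransportPlan (J + K) (μ + μ') (ν + ν')) (hK : IsTransportPlan K μ' ν') :
    IsTransportPlan J μ ν := by
  constructor <;> intro i
  · have := h.1 i
    simpa [sum_add_distrib, hK.1] using this
  · have := h.2 i
    simpa [sum_add_distrib, hK.2] using this

theorem discEMD_le (h : IsTransportPlan J μ ν) : discEMD μ ν ≤ discCost J :=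
  Nat.sInf_le ⟨J, h.1, h.2, rfl⟩

end IsTransportPlan

theorem exists_eq_add_unitPlan {p q : ℕ} {J : Fin p → Fin q → ℕ} {a : Fin p} {b : Fin q}
    (h : J a b ≠ 0) : ∃ R, J = R + unitPlan a b := by
  refine ⟨J - unitPlan a b, (tsub_add_cancel_of_le fun i j => ?_).symm⟩
  rw [unitPlan_apply]
  split_ifs with hij
  · obtain ⟨rfl, rfl⟩ := hij
    exact Nat.one_le_iff_ne_zero.2 h
  · exact Nat.zero_le _

theorem exists_isTransportPlan {p q : ℕ} (s : ℕ) (μ : Fin p → ℕ) (ν : Fin q → ℕ)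
    (hμ : ∑ i, μ i = s) (hν : ∑ j, ν j = s) : ∃ J, IsTransportPlan J μ ν := by
  induction s generalizing μ ν with
  | zero =>
    refine ⟨0, fun i => ?_, fun j => ?_⟩
    · simpa using ((sum_eq_zero_iff.1 hμ) i (mem_univ i)).symm
    · simpa using ((sum_eq_zero_iff.1 hν) j (mem_univ j)).symm
  | succ s ih =>
    have split : ∀ {n : ℕ} (f : Fin n → ℕ), ∑ i, f i = s + 1 →
        ∃ (a : Fin n) (g : Fin n → ℕ), f = g + Pi.single a 1 ∧ ∑ i, g i = s := by
      intro n f hf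
      obtain ⟨a, -, ha⟩ := exists_ne_zero_of_sum_ne_zero (by omega : ∑ i, f i ≠ 0)
      have hfg : f = (f - Pi.single a 1) + Pi.single a 1 := by
        refine (tsub_add_cancel_of_le fun i => ?_).symm
        by_cases hi : i = a
        · subst hi; simp; omega
        · simp [hi]
      refine ⟨a, f - Pi.single a 1, hfg, ?_⟩
      rw [hfg] at hf
      simp only [Pi.add_apply, sum_add_distrib, sum_pi_single', mem_univ, if_true] at hf
      omega
    obtain ⟨a, μ', rfl, hμ'⟩ := split μ hμ
    obtain ⟨b, ν', rfl, hν'⟩ := split ν hν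
    obtain ⟨J, hJ⟩ := ih μ' ν' hμ' hν'
    exact ⟨_, hJ.add (isTransportPlan_unitPlan a b)⟩

theorem exists_discCost_eq_discEMD {p q s : ℕ} {μ : Fin p → ℕ} {ν : Fin q → ℕ}
    (hμ : ∑ i, μ i = s) (hν : ∑ j, ν j = s) :
    ∃ J, IsTransportPlan J μ ν ∧ discCost J = discEMD μ ν := by
  obtain ⟨J, hJ⟩ := exists_isTransportPlan s μ ν hμ hν
  obtain ⟨K, h₁, h₂, h⟩ := Nat.sInf_mem (s := {c | ∃ J : Fin p → Fin q → ℕ,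
    (∀ i, ∑ j, J i j = μ i) ∧ (∀ j, ∑ i, J i j = ν j) ∧ c = discCost J})
    ⟨_, J, hJ.1, hJ.2, rfl⟩
  exact ⟨K, ⟨h₁, h₂⟩, h.symm⟩

theorem discEMD_comm {p q : ℕ} (μ : Fin p → ℕ) (ν : Fin q → ℕ) :
    discEMD μ ν = discEMD ν μ := by
  have cost_swap : ∀ {p q : ℕ} (J : Fin p → Fin q → ℕ),
      discCost J = discCost fun j i => J i j := by
    intro p q J
    rw [discCost, discCost, sum_comm]
    exact sum_congr rfl fun j _ => sum_congr rfl fun i _ => by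
      rw [← Int.natAbs_neg, neg_sub]
  unfold discEMD
  congr 1
  ext c
  constructor
  · rintro ⟨J, h₁, h₂, rfl⟩
    exact ⟨fun j i => J i j, h₂, h₁, cost_swap J⟩
  · rintro ⟨J, h₁, h₂, rfl⟩
    exact ⟨fun j i => J i j, h₂, h₁, cost_swap J⟩

theorem discEMD_snoc_zero_left {p q : ℕ} (μ : Fin p → ℕ) (ν : Fin q → ℕ) :
    discEMD (Fin.snoc μ 0 : Fin (p + 1) → ℕ) ν = discEMD μ ν := by
  unfold discEMD
  congr 1
  ext c
  constructor
  · rintro ⟨J, h₁, h₂, rfl⟩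
    have hlast : ∀ j, J (Fin.last p) j = 0 := fun j =>
      sum_eq_zero_iff.1 ((h₁ (Fin.last p)).trans (Fin.snoc_last _ _)) j (mem_univ j)
    refine ⟨fun i => J i.castSucc, fun i => ?_, fun j => ?_, ?_⟩
    · simpa using h₁ i.castSucc
    · simpa [Fin.sum_univ_castSucc, hlast] using h₂ j
    · simp [discCost, Fin.sum_univ_castSucc (n := p), hlast]
  · rintro ⟨J, h₁, h₂, rfl⟩
    refine ⟨Fin.snoc (α := fun _ => Fin q → ℕ) J 0, fun i => ?_, fun j => ?_, ?_⟩
    · refine Fin.lastCases ?_ (fun i => ?_) i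
      · simp
      · simpa using h₁ i
    · simpa [Fin.sum_univ_castSucc] using h₂ j
    · simp [discCost, Fin.sum_univ_castSucc (n := p)]

theorem discEMD_snoc_zero_right {p q : ℕ} (μ : Fin p → ℕ) (ν : Fin q → ℕ) :
    discEMD μ (Fin.snoc ν 0 : Fin (q + 1) → ℕ) = discEMD μ ν := by
  rw [discEMD_comm, discEMD_snoc_zero_left, discEMD_comm]

/-- By the Monge property of the cost, a plan whose marginals both charge the last index can be
replaced by one which moves a unit of mass from last to last. -/
theorem discEMD_add_single_last {p q s : ℕ} {μ : Fin (p + 1) → ℕ} {ν : Fin (q + 1) → ℕ}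
    (hμ : ∑ i, μ i = s) (hν : ∑ j, ν j = s) :
    discEMD (μ + Pi.single (Fin.last p) 1) (ν + Pi.single (Fin.last q) 1) =
      discEMD μ ν + ((p : ℤ) - (q : ℤ)).natAbs := by
  apply le_antisymm
  · obtain ⟨J, hJ, hcost⟩ := exists_discCost_eq_discEMD hμ hν
    refine (hJ.add (isTransportPlan_unitPlan _ _)).discEMD_le.trans ?_
    rw [discCost_add, discCost_unitPlan, hcost]
    simp
  · obtain ⟨J, hJ, hcost⟩ := exists_discCost_eq_discEMD (s := s + 1)
      (μ := μ + Pi.single (Fin.last p) 1) (ν := ν + Pi.single (Fin.last q) 1)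
      (by simp [sum_add_distrib, hμ]) (by simp [sum_add_distrib, hν])
    rw [← hcost]
    have hrow : ∑ j, J (Fin.last p) j ≠ 0 := by simp [hJ.1]
    obtain ⟨j, -, hj⟩ := exists_ne_zero_of_sum_ne_zero hrow
    obtain ⟨R, rfl⟩ := exists_eq_add_unitPlan hj
    by_cases hjq : j = Fin.last q
    · subst hjq
      have := (hJ.of_add (isTransportPlan_unitPlan _ _)).discEMD_le
      rw [discCost_add, discCost_unitPlan]
      simpa using this
    · have hcol : ∑ i, R i (Fin.last q) ≠ 0 := by
        have := hJ.2 (Fin.last q)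
        simp [unitPlan_apply, Ne.symm hjq] at this
        omega
      obtain ⟨i, -, hi⟩ := exists_ne_zero_of_sum_ne_zero hcol
      obtain ⟨T, rfl⟩ := exists_eq_add_unitPlan hi
      have hT : IsTransportPlan (T + unitPlan i j) μ ν := by
        apply IsTransportPlan.of_add (K := unitPlan (Fin.last p) (Fin.last q)) _
          (isTransportPlan_unitPlan _ _)
        constructor
        · intro k
          rw [← hJ.1 k]
          simp only [Pi.add_apply, sum_add_distrib, (isTransportPlan_unitPlan _ _).1]
        · intro k
          rw [← hJ.2 k]
          simp only [Pi.add_apply, sum_add_distrib, (isTransportPlan_unitPlan _ _).2]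
          ring
      have hle := hT.discEMD_le
      simp only [discCost_add, discCost_unitPlan, Fin.val_last] at hle ⊢
      have := i.is_le
      have := j.is_le
      omega

theorem sum_antidiagonalTuple_succ_succ {M : Type*} [AddCommMonoid M] (p s : ℕ)
    (f : (Fin (p + 1) → ℕ) → M) :
    ∑ μ ∈ antidiagonalTuple (p + 1) (s + 1), f μ =
      ∑ μ ∈ antidiagonalTuple p (s + 1), f (Fin.snoc μ 0 : Fin (p + 1) → ℕ) +
        ∑ μ ∈ antidiagonalTuple (p + 1) s, f (μ + Pi.single (Fin.last p) 1) := by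
  have hcancel : ∀ μ : Fin (p + 1) → ℕ, μ (Fin.last p) ≠ 0 →
      μ - Pi.single (Fin.last p) 1 + Pi.single (Fin.last p) 1 = μ := by
    intro μ h
    refine tsub_add_cancel_of_le fun i => ?_
    by_cases hi : i = Fin.last p
    · subst hi; simp; omega
    · simp [hi]
  rw [← sum_filter_add_sum_filter_not _ (fun μ => μ (Fin.last p) = 0)]
  congr 1
  · symm
    refine sum_nbij' (fun μ => (Fin.snoc μ 0 : Fin (p + 1) → ℕ)) Fin.init ?_ ?_ ?_ ?_ ?_
    · intro μ hμ
      simpa [mem_antidiagonalTuple, Fin.sum_univ_castSucc] using hμ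
    · intro μ hμ
      rw [mem_filter, mem_antidiagonalTuple, Fin.sum_univ_castSucc] at hμ
      simpa [mem_antidiagonalTuple, Fin.init, hμ.2] using hμ.1
    · intro μ _
      simp
    · intro μ hμ
      rw [mem_filter] at hμ
      rw [← hμ.2, Fin.snoc_init_self]
    · intros; rfl
  · symm
    refine sum_nbij' (· + Pi.single (Fin.last p) 1) (· - Pi.single (Fin.last p) 1) ?_ ?_ ?_ ?_ ?_
    · intro μ hμ
      simpa [mem_antidiagonalTuple, sum_add_distrib] using hμ
    · intro μ hμ
      obtain ⟨h, hlast⟩ := mem_filter.1 hμ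
      rw [mem_antidiagonalTuple, ← hcancel μ hlast] at h
      simp only [Pi.add_apply, sum_add_distrib, sum_pi_single', mem_univ, if_true] at h
      exact mem_antidiagonalTuple.2 (by omega)
    · intro μ _
      exact add_tsub_cancel_right _ _
    · intro μ hμ
      exact hcancel μ (mem_filter.1 hμ).2
    · intros; rfl

theorem card_antidiagonalTuple_succ (p s : ℕ) :
    #(antidiagonalTuple (p + 1) s) = (s + p).choose p := by
  induction p generalizing s with
  | zero => simp
  | succ p ihp =>
    induction s with
    | zero => simp [antidiagonalTuple_zero_right]
    | succ s ihs =>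
      rw [card_eq_sum_ones, sum_antidiagonalTuple_succ_succ, ← card_eq_sum_ones,
        ← card_eq_sum_ones, ihp, ihs, show s + 1 + (p + 1) = (s + 1 + p) + 1 by ring,
        Nat.choose_succ_succ, show s + (p + 1) = s + 1 + p by ring]

theorem Nsum_succ_right (p q s : ℕ) :
    Nsum p q (s + 1) = ∑ μ ∈ antidiagonalTuple p (s + 1), ∑ ν ∈ antidiagonalTuple q (s + 1),
      discEMD μ ν := by
  unfold Nsum
  split_ifs with h
  · rcases h with rfl | rfl <;> simp
  · rfl

/-- The recursion for `N(p,q;s)` coming from the generating function identity. -/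
theorem Nsum_recursion (p q s : ℕ) (hp : 1 ≤ p) (hq : 1 ≤ q) (hpq : (p, q) ≠ (1, 1))
    (hs : 1 ≤ s) :
    (Nsum p q s : ℤ) =
      (Nsum (p - 1) q s : ℤ) + (Nsum p (q - 1) s : ℤ) - (Nsum (p - 1) (q - 1) s : ℤ) +
        (Nsum p q (s - 1) : ℤ) + ((p : ℤ) - (q : ℤ)).natAbs * (Kcount p q (s - 1) : ℤ) := by
  obtain ⟨p, rfl⟩ := Nat.exists_eq_add_of_le' hp
  obtain ⟨q, rfl⟩ := Nat.exists_eq_add_of_le' hq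
  obtain ⟨s, rfl⟩ := Nat.exists_eq_add_of_le' hs
  simp only [Nat.add_sub_cancel]
  have hboth : ∑ μ ∈ antidiagonalTuple (p + 1) s, ∑ ν ∈ antidiagonalTuple (q + 1) s,
      discEMD (μ + Pi.single (Fin.last p) 1) (ν + Pi.single (Fin.last q) 1) =
      Nsum (p + 1) (q + 1) s + ((p : ℤ) - (q : ℤ)).natAbs * Kcount (p + 1) (q + 1) s := by
    have hN : Nsum (p + 1) (q + 1) s = ∑ μ ∈ antidiagonalTuple (p + 1) s,
        ∑ ν ∈ antidiagonalTuple (q + 1) s, discEMD μ ν := by simp [Nsum]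
    rw [sum_congr rfl fun μ hμ => sum_congr rfl fun ν hν => discEMD_add_single_last
      (mem_antidiagonalTuple.1 hμ) (mem_antidiagonalTuple.1 hν)]
    simp only [sum_add_distrib, sum_const, card_antidiagonalTuple_succ, hN, smul_eq_mul, Kcount]
    simp only [← add_assoc, Nat.add_sub_cancel]
    ring
  have hleft : Nsum (p + 1) q (s + 1) = Nsum p q (s + 1) +
      ∑ μ ∈ antidiagonalTuple (p + 1) s, ∑ ν ∈ antidiagonalTuple q (s + 1),
        discEMD (μ + Pi.single (Fin.last p) 1) ν := by
    simp only [Nsum_succ_right, sum_antidiagonalTuple_succ_succ p, discEMD_snoc_zero_left]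
  have hfull : Nsum (p + 1) (q + 1) (s + 1) = Nsum p (q + 1) (s + 1) +
      (∑ μ ∈ antidiagonalTuple (p + 1) s, ∑ ν ∈ antidiagonalTuple q (s + 1),
        discEMD (μ + Pi.single (Fin.last p) 1) ν +
      ∑ μ ∈ antidiagonalTuple (p + 1) s, ∑ ν ∈ antidiagonalTuple (q + 1) s,
        discEMD (μ + Pi.single (Fin.last p) 1) (ν + Pi.single (Fin.last q) 1)) := by
    rw [Nsum_succ_right, Nsum_succ_right, sum_antidiagonalTuple_succ_succ p, ← sum_add_distrib]
    congr 1
    · simp only [discEMD_snoc_zero_left]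
    · refine sum_congr rfl fun μ _ => ?_
      simp only [sum_antidiagonalTuple_succ_succ q, discEMD_snoc_zero_right]
  have hdist : ((p + 1 : ℕ) : ℤ) - ((q + 1 : ℕ) : ℤ) = (p : ℤ) - q := by push_cast; ring
  rw [hdist]
  zify at hboth hleft hfull ⊢
  linarith
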